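/- Comparison principle for one-phase physical particle systems: fix N ≥ 1, α > 0, and initial values X^1_{0-},…,X^N_{0-} ≥ 0. Let (G^i)_{1≤i≤N} and (B^i)_{1≤i≤N} be càdlàg paths with G^i_0 = B^i_0 = 0 and G^i_t ≤ B^i_t for all t ≥ 0 and all i. Let ((X̂^i)_{1≤i≤N}, Λ̂^N) and ((X^i)_{1≤i≤N}, Λ^N) be the physical (cascade-minimal) solutions of the respective one-phase systems X̂^i_t = X^i_{0-} + G^i_t − Λ̂^N_t, σ̂^i = inf{t ≥ 0 : X̂^i_t ≤ 0}, Λ̂^N_t = (α/N)·#{i : σ̂^i ≤ t}, and X^i_t = X^i_{0-} + B^i_t − Λ^N_t, σ^i = inf{t ≥ 0 : X^i_t ≤ 0}, Λ^N_t = (α/N)·#{i : σ^i ≤ t}. Then σ̂^i ≤ σ^i for all 1 ≤ i ≤ N, and Λ̂^N_t ≥ Λ^N_t for all t ≥ 0. -/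

import Mathlib

open MeasureTheory ProbabilityTheory Filter Set

/-- The iterated thresholds of the cascade procedure at a cascade time, computed from the
sets of still-alive particles and their pre-cascade positions: `(a_0,b_0) = (0,0)` and,
given `(a_k,b_k)`, the next candidate jump is
`z_{k+1} = (α/N)·#{i alive : xpos i ≤ a_k} - (β/N)·#{i alive : ypos i ≥ b_k}`, with
`a_{k+1} = max a_k z_{k+1}` and `b_{k+1} = min b_k z_{k+1}`. -/
noncomputable def cascadeThresh (N : ℕ) (α β : ℝ) (aliveX aliveY : Set (Fin N))
    (xpos ypos : Fin N → ℝ) : ℕ → ℝ × ℝ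
  | 0 => (0, 0)
  | k + 1 =>
      let ab := cascadeThresh N α β aliveX aliveY xpos ypos k
      let z : ℝ := (α / N) * (Nat.card {i : Fin N // i ∈ aliveX ∧ xpos i ≤ ab.1} : ℝ)
             - (β / N) * (Nat.card {i : Fin N // i ∈ aliveY ∧ ab.2 ≤ ypos i} : ℝ)
      (max ab.1 z, min ab.2 z)

/-- The total jump of the interaction term produced by the (stabilized) cascade procedure:
`(α/N)|∪_j Σ^j| - (β/N)|∪_j Γ^j|`.  The recursion stabilizes after at most `2N + 1` steps.
The one-phase cascade is recovered by taking `β = 0` and `aliveY = ∅`. -/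
noncomputable def cascadeJump (N : ℕ) (α β : ℝ) (aliveX aliveY : Set (Fin N))
    (xpos ypos : Fin N → ℝ) : ℝ :=
  (α / N) * (Nat.card {i : Fin N //
      i ∈ aliveX ∧ xpos i ≤ (cascadeThresh N α β aliveX aliveY xpos ypos (2 * N + 1)).1} : ℝ)
  - (β / N) * (Nat.card {i : Fin N //
      i ∈ aliveY ∧ (cascadeThresh N α β aliveX aliveY xpos ypos (2 * N + 1)).2 ≤ ypos i} : ℝ)

/-- The physical (cascade-minimal) solution of the deterministic one-phase particle system
driven by càdlàg paths `G i` (extended by `0` to nonpositive times):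
`X i t = X0 i + G i t - Λ t`, `σ^i = inf{t ≥ 0 : X^i_t ≤ 0}`,
`Λ_t = (α/N)·#{i : σ^i ≤ t}` (equivalently, by right-continuity of the paths,
`{σ^i ≤ t} = {∃ s ∈ [0,t], X^i_s ≤ 0}`), `Λ` is càdlàg, vanishes on `(-∞,0)`, and at every
time the jump of `Λ` is the minimal one produced by the iterative cascade procedure applied
to the pre-cascade positions `X^i_{t-} = X0 i + G^i_{t-} - Λ_{t-}` of the particles alive at
time `t-`. -/
structure IsPhysicalOnePhase (N : ℕ) (α : ℝ) (X0 : Fin N → ℝ) (G : Fin N → ℝ → ℝ)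
    (X : Fin N → ℝ → ℝ) (Λ : ℝ → ℝ) : Prop where
  eqX : ∀ i t, X i t = X0 i + G i t - Λ t
  Λpre : ∀ t : ℝ, t < 0 → Λ t = 0
  rcont : ∀ t : ℝ, ContinuousWithinAt Λ (Set.Ici t) t
  llim : ∀ t : ℝ, ∃ l : ℝ, Filter.Tendsto Λ (nhdsWithin t (Set.Iio t)) (nhds l)
  rep : ∀ t : ℝ, 0 ≤ t →
    Λ t = (α / N) * (Nat.card {i : Fin N // ∃ s, 0 ≤ s ∧ s ≤ t ∧ X i s ≤ 0} : ℝ)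
  physical : ∀ t : ℝ, 0 ≤ t →
    Λ t = Function.leftLim Λ t +
      cascadeJump N α 0 {i | ∀ s, 0 ≤ s → s < t → 0 < X i s} ∅
        (fun i => X0 i + Function.leftLim (G i) t - Function.leftLim Λ t) (fun _ => 0)

theorem cascadeThresh_succ_fst (N : ℕ) (α : ℝ) (A B : Set (Fin N)) (x y : Fin N → ℝ) (k : ℕ) :
    (cascadeThresh N α 0 A B x y (k + 1)).1 = max (cascadeThresh N α 0 A B x y k).1
      ((α / N) *
        (Nat.card {i : Fin N // i ∈ A ∧ x i ≤ (cascadeThresh N α 0 A B x y k).1} : ℝ)) := by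
  simp [cascadeThresh]

theorem cascadeJump_eq (N : ℕ) (α : ℝ) (A B : Set (Fin N)) (x y : Fin N → ℝ) :
    cascadeJump N α 0 A B x y = (α / N) * (Nat.card {i : Fin N //
      i ∈ A ∧ x i ≤ (cascadeThresh N α 0 A B x y (2 * N + 1)).1} : ℝ) := by
  simp [cascadeJump]

/-- The one-phase cascade has stabilized by the time `cascadeJump` is evaluated. -/
theorem cascadeJump_le_cascadeThresh (N : ℕ) {α : ℝ} (hα : 0 ≤ α) (A B : Set (Fin N))
    (x y : Fin N → ℝ) :
    cascadeJump N α 0 A B x y ≤ (cascadeThresh N α 0 A B x y (2 * N + 1)).1 := by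
  rw [cascadeJump_eq]
  set a : ℕ → ℝ := fun k => (cascadeThresh N α 0 A B x y k).1
  set n : ℕ → ℕ := fun k => Nat.card {i : Fin N // i ∈ A ∧ x i ≤ a k} with hn
  have hsucc : ∀ k, a (k + 1) = max (a k) ((α / N) * (n k : ℝ)) :=
    cascadeThresh_succ_fst N α A B x y
  have key : ∀ k, (α / N) * (n k : ℝ) ≤ a k ∨ k ≤ n k := by
    intro k
    induction k with
    | zero => exact Or.inr (Nat.zero_le _)
    | succ k ih =>
      by_cases hst : (α / N) * (n k : ℝ) ≤ a k
      · have hak : a (k + 1) = a k := by rw [hsucc, max_eq_left hst]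
        left
        simpa only [hn, hak] using hst
      · have hk := ih.resolve_left hst
        have hak : a (k + 1) = (α / N) * (n k : ℝ) := by
          rw [hsucc, max_eq_right (not_le.mp hst).le]
        by_cases hlt : n k < n (k + 1)
        · right
          omega
        · left
          rw [hak]
          have : (n (k + 1) : ℝ) ≤ n k := by exact_mod_cast not_lt.mp hlt
          gcongr
  refine (key (2 * N + 1)).resolve_right fun h => ?_
  have hcard : n (2 * N + 1) ≤ N := by
    simpa using Finite.card_subtype_le (fun i : Fin N => i ∈ A ∧ x i ≤ a (2 * N + 1))
  omega

theorem card_compl_add_card_le {N : ℕ} {A A' : Set (Fin N)} {p q : Fin N → Prop}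
    (hA : A' ⊆ A) (hpq : ∀ i ∈ A', p i → q i) :
    (Nat.card {i : Fin N // i ∉ A} : ℝ) + Nat.card {i : Fin N // i ∈ A ∧ p i} ≤
      (Nat.card {i : Fin N // i ∉ A'} : ℝ) + Nat.card {i : Fin N // i ∈ A' ∧ q i} := by
  classical
  have hdisj : ∀ (S : Set (Fin N)) (r : Fin N → Prop),
      Nat.card {i : Fin N // i ∉ S} + Nat.card {i : Fin N // i ∈ S ∧ r i} =
        (Finset.univ.filter fun i => i ∉ S ∨ r i).card := by
    intro S r
    rw [Nat.card_eq_fintype_card, Nat.card_eq_fintype_card, Fintype.card_subtype,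
      Fintype.card_subtype, ← Finset.card_union_of_disjoint]
    · congr 1
      ext i
      simp only [Finset.mem_union, Finset.mem_filter, Finset.mem_univ, true_and]
      tauto
    · rw [Finset.disjoint_filter]
      tauto
  have h : (Finset.univ.filter fun i => i ∉ A ∨ p i).card ≤
      (Finset.univ.filter fun i => i ∉ A' ∨ q i).card := by
    refine Finset.card_le_card fun i => ?_
    simp only [Finset.mem_filter, Finset.mem_univ, true_and]
    have := hpq i
    have := @hA i
    tauto
  rw [← hdisj, ← hdisj] at h
  exact_mod_cast h

/-- Comparison of the total loss after one cascade: fewer particles alive and lower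
free positions `x' ≤ x` lead to a larger total loss. -/
theorem loss_add_cascadeJump_le {N : ℕ} {α : ℝ} (hα : 0 ≤ α) {A A' : Set (Fin N)} (hA : A' ⊆ A)
    {x x' y y' : Fin N → ℝ} {B B' : Set (Fin N)} (hx : ∀ i, x' i ≤ x i) {l l' : ℝ}
    (hl : l = (α / N) * (Nat.card {i : Fin N // i ∉ A} : ℝ))
    (hl' : l' = (α / N) * (Nat.card {i : Fin N // i ∉ A'} : ℝ)) :
    l + cascadeJump N α 0 A B (fun i => x i - l) y ≤
      l' + cascadeJump N α 0 A' B' (fun i => x' i - l') y' := by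
  have hstab := cascadeJump_le_cascadeThresh N hα A' B' (fun i => x' i - l') y'
  have hJ' := cascadeJump_eq N α A' B' (fun i => x' i - l') y'
  set J' := cascadeJump N α 0 A' B' (fun i => x' i - l') y'
  have hc : 0 ≤ α / N := by positivity
  have step : ∀ a : ℝ, l + a ≤ l' + J' →
      l + (α / N) * (Nat.card {i : Fin N // i ∈ A ∧ x i - l ≤ a} : ℝ) ≤ l' + J' := by
    intro a h
    rw [hJ']
    nth_rewrite 1 [hl]
    nth_rewrite 1 [hl']
    rw [← mul_add, ← mul_add]
    refine mul_le_mul_of_nonneg_left (card_compl_add_card_le hA fun i _ hi => ?_) hc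
    have := hx i
    linarith
  have bound : ∀ k, l + (cascadeThresh N α 0 A B (fun i => x i - l) y k).1 ≤ l' + J' := by
    intro k
    induction k with
    | zero =>
      have h0 := card_compl_add_card_le (p := fun _ => False) (q := fun _ => False) hA
        fun _ _ => id
      have hJ0 : 0 ≤ J' := by rw [hJ']; positivity
      have hll : l ≤ l' := by
        rw [hl, hl']
        refine mul_le_mul_of_nonneg_left ?_ hc
        simpa using h0
      simp only [cascadeThresh]
      linarith
    | succ k ih =>
      rw [cascadeThresh_succ_fst]
      rcases max_choice (cascadeThresh N α 0 A B (fun i => x i - l) y k).1 ((α / N) *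
        (Nat.card {i : Fin N // i ∈ A ∧
          x i - l ≤ (cascadeThresh N α 0 A B (fun i => x i - l) y k).1} : ℝ)) with h | h
      · rw [h]; exact ih
      · rw [h]; exact step _ ih
  rw [cascadeJump_eq]
  exact step _ (bound _)

namespace IsPhysicalOnePhase

variable {N : ℕ} {α : ℝ} {X0 : Fin N → ℝ} {G X : Fin N → ℝ → ℝ} {Λ : ℝ → ℝ}

theorem mono (h : IsPhysicalOnePhase N α X0 G X Λ) (hα : 0 ≤ α) {s t : ℝ} (hs : 0 ≤ s)
    (hst : s ≤ t) : Λ s ≤ Λ t := by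
  rw [h.rep s hs, h.rep t (hs.trans hst)]
  have : Nat.card {i : Fin N // ∃ u, 0 ≤ u ∧ u ≤ s ∧ X i u ≤ 0} ≤
      Nat.card {i : Fin N // ∃ u, 0 ≤ u ∧ u ≤ t ∧ X i u ≤ 0} :=
    Nat.card_le_card_of_injective
      (Subtype.map id fun i ⟨u, hu0, hus, hu⟩ => ⟨u, hu0, hus.trans hst, hu⟩)
      (Subtype.map_injective _ Function.injective_id)
  gcongr

/-- The interaction term just before `t` counts the particles absorbed before `t`. -/
theorem leftLim_eq (h : IsPhysicalOnePhase N α X0 G X Λ) {t : ℝ} (ht : 0 ≤ t) :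
    Function.leftLim Λ t = (α / N) *
      (Nat.card {i : Fin N // i ∉ {i | ∀ s, 0 ≤ s → s < t → 0 < X i s}} : ℝ) := by
  refine leftLim_eq_of_tendsto ?_
  refine tendsto_const_nhds.congr' ?_
  rcases ht.eq_or_lt with rfl | ht
  · filter_upwards [self_mem_nhdsWithin] with s hs
    rw [h.Λpre s hs]
    have : IsEmpty {i : Fin N // ¬ ∀ s, 0 ≤ s → s < 0 → 0 < X i s} :=
      ⟨fun i => i.2 fun s h0 h1 => absurd h0 (not_le.mpr h1)⟩
    simp only [Nat.card_of_isEmpty, Nat.cast_zero, mul_zero]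
  · have hev : ∀ᶠ s in nhdsWithin t (Iio t), ∀ i, (∃ u, 0 ≤ u ∧ u < t ∧ X i u ≤ 0) →
        ∃ u, 0 ≤ u ∧ u ≤ s ∧ X i u ≤ 0 := by
      rw [eventually_all]
      intro i
      by_cases hi : ∃ u, 0 ≤ u ∧ u < t ∧ X i u ≤ 0
      · obtain ⟨u, hu0, hut, hu⟩ := hi
        filter_upwards [Ioo_mem_nhdsLT hut] with s hs _
        exact ⟨u, hu0, hs.1.le, hu⟩
      · exact Eventually.of_forall fun s hi' => absurd hi' hi
    filter_upwards [hev, Ioo_mem_nhdsLT ht] with s hs hst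
    rw [h.rep s hst.1.le]
    congr 2
    refine Nat.card_congr (Equiv.subtypeEquivRight fun i => ?_)
    simp only [not_forall, not_lt, exists_prop]
    exact ⟨hs i, fun ⟨u, hu0, hus, hu⟩ => ⟨u, hu0, hus.trans_lt hst.2, hu⟩⟩

/-- The interaction term is a right-continuous step function. -/
theorem eventually_le (h : IsPhysicalOnePhase N α X0 G X Λ) (hN : 1 ≤ N) (hα : 0 < α) {t : ℝ}
    (ht : 0 ≤ t) : ∀ᶠ s in nhdsWithin t (Ici t), Λ s ≤ Λ t := by
  have hc : 0 < α / N := by positivity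
  filter_upwards [(h.rcont t).eventually (gt_mem_nhds (lt_add_of_pos_right (Λ t) hc)),
    self_mem_nhdsWithin] with s hs hts
  rw [h.rep s (ht.trans hts), h.rep t ht] at hs ⊢
  rw [← mul_add_one, mul_lt_mul_iff_right₀ hc] at hs
  refine mul_le_mul_of_nonneg_left ?_ hc.le
  exact_mod_cast Nat.lt_succ_iff.mp (by exact_mod_cast hs)

end IsPhysicalOnePhase

/-- Comparison principle for physical one-phase particle systems: if the càdlàg drivers
satisfy `G^i ≤ B^i` pathwise, then the hitting times satisfy `σ̂^i ≤ σ^i` (hitting by time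
`t` for the `B`-system implies hitting by time `t` for the `G`-system) and the interaction
terms satisfy `Λ̂^N ≥ Λ^N` everywhere. -/
theorem one_phase_comparison_principle
    (N : ℕ) (hN : 1 ≤ N) (α : ℝ) (hα : 0 < α)
    (X0 : Fin N → ℝ) (hX0 : ∀ i, 0 ≤ X0 i)
    (G Bp : Fin N → ℝ → ℝ)
    (hGrc : ∀ i, ∀ t : ℝ, ContinuousWithinAt (G i) (Set.Ici t) t)
    (hGll : ∀ i, ∀ t : ℝ, ∃ l : ℝ, Filter.Tendsto (G i) (nhdsWithin t (Set.Iio t)) (nhds l))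
    (hBrc : ∀ i, ∀ t : ℝ, ContinuousWithinAt (Bp i) (Set.Ici t) t)
    (hBll : ∀ i, ∀ t : ℝ, ∃ l : ℝ, Filter.Tendsto (Bp i) (nhdsWithin t (Set.Iio t)) (nhds l))
    (hG0 : ∀ i, ∀ t : ℝ, t ≤ 0 → G i t = 0) (hB0 : ∀ i, ∀ t : ℝ, t ≤ 0 → Bp i t = 0)
    (hle : ∀ i, ∀ t : ℝ, 0 ≤ t → G i t ≤ Bp i t)
    (Xhat X : Fin N → ℝ → ℝ) (Λhat Λ : ℝ → ℝ)
    (hhat : IsPhysicalOnePhase N α X0 G Xhat Λhat)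
    (hsys : IsPhysicalOnePhase N α X0 Bp X Λ) :
    (∀ i, ∀ t : ℝ, 0 ≤ t →
      (∃ s, 0 ≤ s ∧ s ≤ t ∧ X i s ≤ 0) → (∃ s, 0 ≤ s ∧ s ≤ t ∧ Xhat i s ≤ 0)) ∧
    (∀ t : ℝ, 0 ≤ t → Λ t ≤ Λhat t) := by
  have hX : ∀ i t, 0 ≤ t → Λ t ≤ Λhat t → Xhat i t ≤ X i t := by
    intro i t ht h
    rw [hhat.eqX, hsys.eqX]
    have := hle i t ht
    linarith
  have hlim : ∀ i t, 0 ≤ t → Function.leftLim (G i) t ≤ Function.leftLim (Bp i) t := by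
    intro i t ht
    obtain ⟨l, hl⟩ := hGll i t
    obtain ⟨m, hm⟩ := hBll i t
    rw [leftLim_eq_of_tendsto hl,
      leftLim_eq_of_tendsto hm]
    refine le_of_tendsto_of_tendsto' hl hm fun s => ?_
    rcases le_total s 0 with hs | hs
    · rw [hG0 i s hs, hB0 i s hs]
    · exact hle i s hs
  have hmain : ∀ t, 0 ≤ t → Λ t ≤ Λhat t := by
    by_contra! hne
    set S : Set ℝ := {t | 0 ≤ t ∧ Λhat t < Λ t}
    have hSne : S.Nonempty := hne
    have hbdd : BddBelow S := ⟨0, fun t ht => ht.1⟩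
    set t₀ := sInf S
    have h0 : 0 ≤ t₀ := le_csInf hSne fun t ht => ht.1
    have hbefore : ∀ s, 0 ≤ s → s < t₀ → Λ s ≤ Λhat s := fun s hs hst =>
      not_lt.mp fun hlt => notMem_of_lt_csInf hst hbdd ⟨hs, hlt⟩
    have hat₀ : Λ t₀ ≤ Λhat t₀ := by
      rw [hsys.physical t₀ h0, hhat.physical t₀ h0]
      refine loss_add_cascadeJump_le hα.le ?_ ?_ (hsys.leftLim_eq h0) (hhat.leftLim_eq h0)
      · intro i hi s hs hst
        exact (hi s hs hst).trans_le (hX i s hs (hbefore s hs hst))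
      · intro i
        have := hlim i t₀ h0
        linarith
    obtain ⟨u, hu, hsub⟩ :=
      mem_nhdsGE_iff_exists_Ico_subset.mp (hsys.eventually_le hN hα h0)
    obtain ⟨s, hs, hsu⟩ := exists_lt_of_csInf_lt hSne hu
    have hts : t₀ ≤ s := csInf_le hbdd hs
    have h1 : Λ s ≤ Λ t₀ := hsub ⟨hts, hsu⟩
    have h2 := hhat.mono hα.le h0 hts
    have h3 := hs.2
    linarith
  refine ⟨?_, hmain⟩
  rintro i t - ⟨s, hs, hst, hXs⟩
  exact ⟨s, hs, hst, (hX i s hs (hmain s hs)).trans hXs⟩
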